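/- arXiv:1511.08133 — 4 statements merged into one kernel-verified Lean document; each statement's English description precedes it below -/
import Mathlib

section
/- Let (X,d) be a finite ultrametric space with |X| ≥ 2. Then every surjective self-isometry of X has at least |X| − 2 fixed points (i.e., min_{g ∈ Iso(X)} |Fix(g)| = |X| − 2) if and only if X has exactly two surjective self-isometries, i.e., |Iso(X)| = 2. -/
/-- Swapping two points at minimal positive distance preserves an ultrametric. -/
theorem dist_swap_of_minimal {X : Type*} [MetricSpace X] [IsUltrametricDist X] [DecidableEq X]
    {a b : X} (hmin : ∀ x y : X, x ≠ y → dist a b ≤ dist x y) (x y : X) :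
    dist (Equiv.swap a b x) (Equiv.swap a b y) = dist x y := by
  have key : ∀ z, z ≠ a → z ≠ b → dist a z = dist b z := by
    intro z hza hzb
    apply le_antisymm
    · exact (dist_triangle_max a b z).trans (max_le (hmin b z hzb.symm) le_rfl)
    · refine (dist_triangle_max b a z).trans (max_le ?_ le_rfl)
      rw [dist_comm b a]
      exact hmin a z hza.symm
  simp only [Equiv.swap_apply_def]
  split_ifs <;> simp_all [dist_comm]

/-- A finite ultrametric space with at least two points has a transposition preserving distances. -/
theorem exists_swap_dist_eq {X : Type*} [MetricSpace X] [IsUltrametricDist X] [Fintype X]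
    [DecidableEq X] (hcard : 2 ≤ Fintype.card X) :
    ∃ a b : X, a ≠ b ∧
      ∀ x y : X, dist (Equiv.swap a b x) (Equiv.swap a b y) = dist x y := by
  obtain ⟨u, v, huv⟩ := Fintype.exists_pair_of_one_lt_card hcard
  obtain ⟨⟨a, b⟩, hab, hmin⟩ := (Finset.univ : Finset X).offDiag.exists_min_image
    (fun p => dist p.1 p.2) ⟨(u, v), by simpa using huv⟩
  exact ⟨a, b, by simpa using hab,
    dist_swap_of_minimal fun x y hxy => hmin (x, y) (by simpa using hxy)⟩

/-- The numbers of fixed and moved points of a permutation add up to the number of points. -/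
theorem Equiv.Perm.ncard_fixed_add_card_support {X : Type*} [Fintype X] [DecidableEq X]
    (σ : Equiv.Perm X) : {x : X | σ x = x}.ncard + σ.support.card = Fintype.card X := by
  have h : {x : X | σ x = x} = ((σ.supportᶜ : Finset X) : Set X) := by
    ext x
    simp
  rw [h, Set.ncard_coe_finset, Finset.card_compl_add_card]

/-- A permutation moving at most two points is the identity or a transposition. -/
theorem Equiv.Perm.eq_one_or_isSwap_of_card_support_le_two {X : Type*} [Fintype X]
    [DecidableEq X] {σ : Equiv.Perm X} (h : σ.support.card ≤ 2) : σ = 1 ∨ σ.IsSwap := by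
  by_cases h1 : σ = 1
  · exact Or.inl h1
  · exact Or.inr (Equiv.Perm.card_support_eq_two.mp
      (le_antisymm h (Equiv.Perm.two_le_card_support_of_ne_one h1)))

/-- For a finite ultrametric space `X` with `|X| ≥ 2`: every
surjective self-isometry of `X` has at least `|X| - 2` fixed points if and
only if `X` has exactly two surjective self-isometries. -/
theorem stmt6 (X : Type*) [MetricSpace X] [IsUltrametricDist X] [Fintype X]
    (hcard : 2 ≤ Fintype.card X) :
    (∀ g : X → X, Function.Surjective g → (∀ x y : X, dist (g x) (g y) = dist x y) →
        Fintype.card X - 2 ≤ {x : X | g x = x}.ncard) ↔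
      Nat.card {g : X → X // Function.Surjective g ∧
        ∀ x y : X, dist (g x) (g y) = dist x y} = 2 := by
  classical
  obtain ⟨a, b, hab, hs⟩ := exists_swap_dist_eq (X := X) hcard
  let i : {g : X → X // Function.Surjective g ∧ ∀ x y : X, dist (g x) (g y) = dist x y} :=
    ⟨id, Function.surjective_id, fun _ _ => rfl⟩
  let s : {g : X → X // Function.Surjective g ∧ ∀ x y : X, dist (g x) (g y) = dist x y} :=
    ⟨Equiv.swap a b, (Equiv.swap a b).surjective, hs⟩
  have his : i ≠ s := by
    intro h
    have h' := congrFun (congrArg Subtype.val h) a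
    simp only [i, s, id, Equiv.swap_apply_left] at h'
    exact hab h'
  constructor
  · intro H
    have hsupp : ∀ σ : Equiv.Perm X, (∀ x y, dist (σ x) (σ y) = dist x y) →
        σ = 1 ∨ σ.IsSwap := by
      intro σ hσ
      apply Equiv.Perm.eq_one_or_isSwap_of_card_support_le_two
      have h1 := H σ σ.surjective hσ
      have h2 := σ.ncard_fixed_add_card_support
      omega
    refine Nat.card_eq_two_iff.mpr ⟨i, s, his, Set.eq_univ_of_forall ?_⟩
    rintro ⟨g, hg, hd⟩
    let σ : Equiv.Perm X := Equiv.ofBijective g (Finite.injective_iff_bijective.mp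
      (Finite.injective_iff_surjective.mpr hg))
    rcases hsupp σ hd with h1 | h1
    · left
      exact Subtype.ext (funext fun x => congrArg (fun τ : Equiv.Perm X => τ x) h1)
    · right
      have h2 : Equiv.swap a b * σ = 1 := by
        refine (hsupp _ fun x y => (hs (σ x) (σ y)).trans (hd x y)).resolve_right fun h3 => ?_
        have h4 := h3.sign_eq
        rw [Equiv.Perm.sign_mul, Equiv.Perm.sign_swap hab, h1.sign_eq] at h4
        exact absurd h4 (by decide)
      have h3 : σ = Equiv.swap a b := by
        rw [eq_inv_of_mul_eq_one_right h2, Equiv.swap_inv]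
      exact Subtype.ext (funext fun x => congrArg (fun τ : Equiv.Perm X => τ x) h3)
  · intro H g hg hd
    have hall : (⟨g, hg, hd⟩ : {g : X → X // Function.Surjective g ∧
        ∀ x y : X, dist (g x) (g y) = dist x y}) = i ∨ ⟨g, hg, hd⟩ = s := by
      by_contra! hne
      have : Finite {g : X → X // Function.Surjective g ∧
          ∀ x y : X, dist (g x) (g y) = dist x y} := Subtype.finite
      have h3 := Set.ncard_le_card ({⟨g, hg, hd⟩, i, s} : Set {g : X → X //
        Function.Surjective g ∧ ∀ x y : X, dist (g x) (g y) = dist x y})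
      rw [Set.ncard_eq_three.mpr ⟨_, _, _, hne.1, hne.2, his, rfl⟩] at h3
      omega
    rcases hall with h | h
    · obtain rfl : g = id := congrArg Subtype.val h
      simp [Set.ncard_univ]
    · obtain rfl : g = Equiv.swap a b := congrArg Subtype.val h
      have h2 := (Equiv.swap a b).ncard_fixed_add_card_support
      rw [Equiv.Perm.card_support_swap hab] at h2
      omega
end

section
/- Let (X,d) be a finite ultrametric space with |X| ≥ 2. Then X ∈ ℜ if and only if for every ball B of X with diam B > 0, the diametrical graph G_B of the subspace (B,d) is a star. -/
/-- The set of all (closed) balls of a metric space. -/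
def metricBalls (X : Type*) [MetricSpace X] : Set (Set X) :=
  {B | ∃ (t : X) (r : ℝ), 0 ≤ r ∧ B = {x : X | dist x t ≤ r}}

/-- Membership in the class `ℜ`: every surjective self-isometry of `X` has at
least `|X| - 2` fixed points. -/
def maxRigid (X : Type*) [MetricSpace X] : Prop :=
  ∀ g : X → X, Function.Surjective g → (∀ x y : X, dist (g x) (g y) = dist x y) →
    Nat.card X - 2 ≤ {x : X | g x = x}.ncard

section StarBalls

variable {X : Type*} [MetricSpace X]

/-- Two points are twins if they are distinct and every other point is equidistant from them. -/
def AreTwins (x y : X) : Prop :=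
  x ≠ y ∧ ∀ z, z ≠ x → z ≠ y → dist z x = dist z y

theorem AreTwins.dist_swap [DecidableEq X] {x y : X} (h : AreTwins x y) (u v : X) :
    dist (Equiv.swap x y u) (Equiv.swap x y v) = dist u v := by
  have h2 := h.2
  have h3 : ∀ z, z ≠ x → z ≠ y → dist x z = dist y z := by
    intro z hx hy
    rw [dist_comm x, dist_comm y, h2 z hx hy]
  have hc := dist_comm x y
  simp only [Equiv.swap_apply_def]
  split_ifs <;> simp_all

/-- In a space of the class `ℜ` there is at most one pair of twins. -/
theorem AreTwins.eq_or_eq_of_maxRigid [Finite X] (hX : maxRigid X) {x y u v : X}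
    (hxy : AreTwins x y) (huv : AreTwins u v) : u = x ∨ u = y := by
  classical
  by_contra! hu
  let g : X → X := fun z => Equiv.swap x y (Equiv.swap u v z)
  have hg := hX g ((Equiv.swap x y).surjective.comp (Equiv.swap u v).surjective)
    (fun a b => by simp only [g, hxy.dist_swap, huv.dist_swap])
  have hne := hxy.1
  have hne' := huv.1
  have hmoved : ({x, y, u} : Set X) ⊆ {z : X | g z = z}ᶜ := by
    intro z hz
    simp only [Set.mem_insert_iff, Set.mem_singleton_iff] at hz
    simp only [Set.mem_compl_iff, Set.mem_ofPred_eq, g, Equiv.swap_apply_def]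
    grind
  have h3 : ({x, y, u} : Set X).ncard = 3 :=
    Set.ncard_eq_three.mpr ⟨x, y, u, hne, hu.1.symm, hu.2.symm, rfl⟩
  have hle := Set.ncard_le_ncard hmoved (Set.toFinite _)
  have hsum := Set.ncard_add_ncard_compl {z : X | g z = z}
  omega

variable [IsUltrametricDist X]

/-- Every closed ball with at least two points contains a pair of twins. -/
theorem exists_areTwins_mem_ball [Finite X] {x y : X} (hxy : x ≠ y) :
    ∃ u v, AreTwins u v ∧ dist u x ≤ dist x y ∧ dist v x ≤ dist x y := by
  let S : Set (X × X) :=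
    {p | p.1 ≠ p.2 ∧ dist p.1 x ≤ dist x y ∧ dist p.2 x ≤ dist x y}
  obtain ⟨⟨u, v⟩, ⟨hne, hu, hv⟩, hmin⟩ :=
    Set.exists_min_image S (fun p => dist p.1 p.2) (Set.toFinite S)
      ⟨(x, y), hxy, by simp, by simp [dist_comm]⟩
  simp only at hne hu hv hmin
  have huv : dist u v ≤ dist x y := by
    have h1 := dist_triangle_max u x v
    rw [dist_comm x v] at h1
    exact h1.trans (max_le hu hv)
  have key : ∀ z, z ≠ u → z ≠ v → dist u v ≤ dist z u ∧ dist u v ≤ dist z v := by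
    intro z hzu hzv
    by_cases hz : dist z x ≤ dist x y
    · exact ⟨hmin (z, u) ⟨hzu, hz, hu⟩, hmin (z, v) ⟨hzv, hz, hv⟩⟩
    · have h1 := dist_triangle_max z u x
      have h2 := dist_triangle_max z v x
      grind
  refine ⟨u, v, ⟨hne, fun z hzu hzv => ?_⟩, hu, hv⟩
  obtain ⟨h1, h2⟩ := key z hzu hzv
  apply le_antisymm
  · have h := dist_triangle_max z v u
    rw [dist_comm v u] at h
    exact h.trans (max_le le_rfl h2)
  · exact (dist_triangle_max z u v).trans (max_le le_rfl h1)

/-- A space of the class `ℜ` has a pair of twins, one of which belongs to all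
closed balls with at least two points. -/
theorem exists_areTwins_forall_dist_le [Finite X] [Nontrivial X] (hX : maxRigid X) :
    ∃ p q : X, AreTwins p q ∧ ∀ x y : X, x ≠ y → dist x p ≤ dist x y := by
  obtain ⟨a, b, hab⟩ := exists_pair_ne X
  obtain ⟨p, q, hpq, -, -⟩ := exists_areTwins_mem_ball hab
  refine ⟨p, q, hpq, fun x y hxy => ?_⟩
  obtain ⟨u, v, huv, hu, hv⟩ := exists_areTwins_mem_ball hxy
  rcases huv.eq_or_eq_of_maxRigid hX hpq with h | h
  · rwa [h, dist_comm]
  · rwa [h, dist_comm]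

theorem exists_star_center_of_maxRigid [Finite X] [Nontrivial X] (hX : maxRigid X) {B : Set X}
    (hB : B ∈ metricBalls X) (hpos : 0 < Metric.diam B) :
    B.Nontrivial ∧ ∃ c ∈ B, ∀ u ∈ B, ∀ v ∈ B, u ≠ v →
      (dist u v = Metric.diam B ↔ u = c ∨ v = c) := by
  obtain ⟨p, q, hpq, hp⟩ := exists_areTwins_forall_dist_le hX
  have hmax : ∀ x y : X, x ≠ y → dist x y = max (dist x p) (dist y p) := by
    intro x y hxy
    apply le_antisymm
    · have h := dist_triangle_max x p y
      rwa [dist_comm p y] at h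
    · refine max_le (hp x y hxy) ?_
      rw [dist_comm x y]
      exact hp y x hxy.symm
  have hbdd : Bornology.IsBounded B := (Set.toFinite B).isBounded
  have hnt : B.Nontrivial := by
    by_contra h
    rw [Set.not_nontrivial_iff] at h
    exact hpos.ne' (Metric.diam_subsingleton h)
  obtain ⟨x₀, hx₀, y₀, hy₀, hne₀⟩ := hnt
  have hpB : p ∈ B := by
    obtain ⟨t, r, hr, rfl⟩ := hB
    have h1 := dist_triangle_max p x₀ t
    have h2 := dist_triangle_max x₀ t y₀
    have h3 := hp x₀ y₀ hne₀
    simp only [Set.mem_ofPred_eq] at *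
    rw [dist_comm p x₀] at h1
    rw [dist_comm t y₀] at h2
    exact h1.trans (max_le (h3.trans (h2.trans (max_le hx₀ hy₀))) hx₀)
  have hle : ∀ z ∈ B, dist z p ≤ Metric.diam B := fun z hz =>
    Metric.dist_le_diam_of_mem hbdd hz hpB
  obtain ⟨c, hc, hcD⟩ : ∃ c ∈ B, dist c p = Metric.diam B := by
    obtain ⟨c, hc, hcmax⟩ := Set.exists_max_image B (fun z => dist z p) (Set.toFinite B) ⟨p, hpB⟩
    refine ⟨c, hc, le_antisymm (hle c hc) ?_⟩
    refine Metric.diam_le_of_forall_dist_le dist_nonneg fun x hx y hy => ?_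
    by_cases hxy : x = y
    · rw [hxy, dist_self]
      exact dist_nonneg
    · rw [hmax x y hxy]
      exact max_le (hcmax x hx) (hcmax y hy)
  have huniq : ∀ z, dist z p = Metric.diam B → z = c := by
    intro z hz
    by_contra hzc
    have htw : AreTwins z c := by
      refine ⟨hzc, fun w hwz hwc => ?_⟩
      rw [hmax w z hwz, hmax w c hwc, hz, hcD]
    rcases htw.eq_or_eq_of_maxRigid hX hpq with h | h
    · rw [← h, dist_self] at hz
      exact hpos.ne hz
    · rw [← h, dist_self] at hcD
      exact hpos.ne hcD
  refine ⟨⟨x₀, hx₀, y₀, hy₀, hne₀⟩, c, hc, fun u hu v hv huv => ?_⟩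
  rw [hmax u v huv]
  constructor
  · intro h
    rcases max_choice (dist u p) (dist v p) with h' | h'
    · exact Or.inl (huniq u (h' ▸ h))
    · exact Or.inr (huniq v (h' ▸ h))
  · rintro (rfl | rfl)
    · rw [hcD]
      exact max_eq_left (hle v hv)
    · rw [hcD]
      exact max_eq_right (hle u hu)

theorem diam_setOf_dist_le_dist [Finite X] (x y : X) :
    Metric.diam {z : X | dist z x ≤ dist x y} = dist x y := by
  apply le_antisymm
  · refine Metric.diam_le_of_forall_dist_le dist_nonneg fun u hu v hv => ?_
    have h := dist_triangle_max u x v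
    rw [dist_comm x v] at h
    exact h.trans (max_le hu hv)
  · exact Metric.dist_le_diam_of_mem (Set.toFinite _).isBounded (by simp) (by simp [dist_comm])

/-- If all balls are stars, a self-isometry moves at most the two points of one orbit. -/
theorem eq_or_eq_of_isometry_ne
    (hstar : ∀ x y : X, x ≠ y → ∃ c, ∀ u v, dist u x ≤ dist x y → dist v x ≤ dist x y → u ≠ v →
      (dist u v = dist x y ↔ u = c ∨ v = c))
    {g : X → X} (hg : ∀ x y : X, dist (g x) (g y) = dist x y) {x x' : X}
    (hx : g x ≠ x) (hx' : g x' ≠ x') : x' = x ∨ x' = g x := by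
  have hinj : Function.Injective g := (Isometry.of_dist_eq hg).injective
  have hmem : ∀ x z, dist z x ≤ dist x (g x) → dist (g z) x ≤ dist x (g x) := by
    intro x z hz
    have h := dist_triangle_max (g z) (g x) x
    rw [hg, dist_comm (g x) x] at h
    exact h.trans (max_le hz le_rfl)
  have hball : ∀ x z, g x ≠ x → dist z x ≤ dist x (g x) → z = x ∨ z = g x := by
    intro x z hx hz
    by_contra! hzne
    obtain ⟨c, hc⟩ := hstar x (g x) hx.symm
    have hxx : dist x x ≤ dist x (g x) := by simp
    have hgx := hmem x x hxx
    have hgz := hmem x z hz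
    have hggx := hmem x (g x) hgx
    have hz' := hinj.ne hzne.1
    have hgg := hinj.ne hx
    have hgzg := hinj.ne hzne.2
    have h1 := hg z x
    have h2 := hg z (g x)
    have a1 := hc x (g x) hxx hgx hx.symm
    have a2 := hc z x hz hxx hzne.1
    have a3 := hc z (g x) hz hgx hzne.2
    have a4 := hc (g z) (g x) hgz hgx hz'
    have a5 := hc (g z) (g (g x)) hgz hggx hgzg
    grind
  have hswap : g (g x) = x := by
    have := hball x (g (g x)) hx (hmem x (g x) (by simp [dist_comm]))
    exact this.resolve_right (hinj.ne hx)
  by_contra! hne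
  have hd : dist x (g x) < dist x' x := by
    by_contra! h
    rcases hball x x' hx h with h | h
    · exact hne.1 h
    · exact hne.2 h
  have hxg : x ≠ g x' := by
    intro h
    exact hne.2 (hinj (h.symm.trans hswap.symm))
  have hd' : dist x' (g x') < dist x x' := by
    by_contra! h
    rcases hball x' x hx' h with h | h
    · exact hne.1 h.symm
    · exact hxg h
  obtain ⟨c, hc⟩ := hstar x x' hne.1.symm
  have e := dist_comm x x'
  have e0 := dist_comm x (g x)
  have e1 : dist (g x) x' = dist x x' := by
    have i1 := dist_triangle_max (g x) x x'
    have i2 := dist_triangle_max x (g x) x'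
    grind
  have e2 : dist x (g x') = dist x x' := by
    have i1 := dist_triangle_max x x' (g x')
    have i2 := dist_triangle_max x (g x') x'
    have i3 := dist_comm x' (g x')
    grind
  have hxx : dist x x ≤ dist x x' := by simp
  have b1 := hc x x' hxx e.ge hne.1.symm
  have b2 := hc (g x) x' (by grind) e.ge hne.2.symm
  have b3 := hc x (g x') hxx (by rw [dist_comm, e2]) hxg
  grind

theorem maxRigid_of_forall_star [Finite X]
    (h : ∀ B ∈ metricBalls X, 0 < Metric.diam B →
      (B.Nontrivial ∧ ∃ c ∈ B, ∀ u ∈ B, ∀ v ∈ B, u ≠ v →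
        (dist u v = Metric.diam B ↔ u = c ∨ v = c))) : maxRigid X := by
  intro g _ hg
  have hstar : ∀ x y : X, x ≠ y → ∃ c, ∀ u v, dist u x ≤ dist x y → dist v x ≤ dist x y →
      u ≠ v → (dist u v = dist x y ↔ u = c ∨ v = c) := by
    intro x y hxy
    obtain ⟨-, c, -, hc⟩ := h {z : X | dist z x ≤ dist x y} ⟨x, dist x y, dist_nonneg, rfl⟩
      (by rw [diam_setOf_dist_le_dist]; exact dist_pos.mpr hxy)
    rw [diam_setOf_dist_le_dist] at hc
    exact ⟨c, fun u v hu hv => hc u hu v hv⟩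
  have hcompl : {x : X | g x = x}ᶜ.ncard ≤ 2 := by
    rcases Set.eq_empty_or_nonempty {x : X | g x = x}ᶜ with h0 | ⟨x, hx⟩
    · simp [h0]
    · have hsub : {x : X | g x = x}ᶜ ⊆ {x, g x} := fun x' hx' =>
        eq_or_eq_of_isometry_ne hstar hg hx hx'
      exact (Set.ncard_le_ncard hsub (Set.toFinite _)).trans (Set.ncard_pair (Ne.symm hx)).le
  have hsum := Set.ncard_add_ncard_compl {z : X | g z = z}
  omega

end StarBalls

/-- A finite ultrametric space `X` with `|X| ≥ 2` belongs to
`ℜ` if and only if for every ball `B` of `X` with `diam B > 0` the diametrical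
graph of the subspace `B` is a star: `B` has at least two points and there is
a center `c ∈ B` such that distinct `u, v ∈ B` are at distance `diam B`
exactly when one of them is `c`. -/
theorem stmt8 (X : Type*) [MetricSpace X] [IsUltrametricDist X] [Fintype X]
    (hcard : 2 ≤ Fintype.card X) :
    maxRigid X ↔
      ∀ B ∈ metricBalls X, 0 < Metric.diam B →
        (B.Nontrivial ∧ ∃ c ∈ B, ∀ u ∈ B, ∀ v ∈ B, u ≠ v →
          (dist u v = Metric.diam B ↔ u = c ∨ v = c)) := by
  have : Nontrivial X := Fintype.one_lt_card_iff_nontrivial.mp hcard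
  exact ⟨fun hX _ hB hpos => exists_star_center_of_maxRigid hX hB hpos, maxRigid_of_forall_star⟩
end

section
/- Let (X,d) be a finite ultrametric space with n = |X| ≥ 3. Then X ∈ ℜ if and only if there is an enumeration x_1, …, x_n of all points of X such that d(x_1, x_2) = d(x_n, x_1) = max{ d(x_k, x_{k+1 mod n-cycle edges}) } (i.e., both edges {x_1,x_2} and {x_n,x_1} achieve the maximal distance among the n cycle edges {x_1,x_2}, …, {x_{n−1},x_n}, {x_n,x_1}) and d(x_k, x_{k+1}) > d(x_{k+1}, x_{k+2}) for every k = 1, …, n−2. -/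
/-- Two points are twins if no third point distinguishes them by its distance. -/
def IsTwin {X : Type*} [MetricSpace X] (p q : X) : Prop :=
  ∀ z, z ≠ p → z ≠ q → dist p z = dist q z

theorem IsTwin.dist_swap {X : Type*} [MetricSpace X] [DecidableEq X] {p q : X}
    (h : IsTwin p q) (a b : X) :
    dist (Equiv.swap p q a) (Equiv.swap p q b) = dist a b := by
  have h1 : ∀ z, z ≠ p → z ≠ q → dist z p = dist z q := fun z hp hq => by
    rw [dist_comm z p, dist_comm z q, h z hp hq]
  unfold IsTwin at h
  have := dist_comm p q
  simp only [Equiv.swap_apply_def]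
  grind [dist_self]

theorem exists_isTwin {X : Type*} [MetricSpace X] [IsUltrametricDist X] [Finite X]
    (S : X → Prop) {x y : X} (hx : S x) (hxy : x ≠ y)
    (hS : ∀ p q, S p → dist p q ≤ dist x y → S q) :
    ∃ p q, S p ∧ S q ∧ p ≠ q ∧ IsTwin p q ∧ ∀ a b, S a → a ≠ b → dist p q ≤ dist a b := by
  obtain ⟨⟨p, q⟩, ⟨hp, hpq⟩, hmin⟩ := Set.exists_min_image
    {u : X × X | S u.1 ∧ u.1 ≠ u.2} (fun u => dist u.1 u.2) (Set.toFinite _) ⟨(x, y), hx, hxy⟩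
  have hm : ∀ a b, S a → a ≠ b → dist p q ≤ dist a b := fun a b ha hab => hmin (a, b) ⟨ha, hab⟩
  have hq : S q := hS p q hp (hm x y hx hxy)
  refine ⟨p, q, hp, hq, hpq, fun z hzp hzq => le_antisymm ?_ ?_, hm⟩
  · exact (dist_triangle_max p q z).trans (max_le (hm q z hq hzq.symm) le_rfl)
  · refine (dist_triangle_max q p z).trans (max_le ?_ le_rfl)
    rw [dist_comm q p]
    exact hm p z hp hzp.symm

theorem maxRigid.eq_or_eq_or_eq {X : Type*} [MetricSpace X] [Finite X] (h : maxRigid X)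
    {g : X → X} (hg : Function.Surjective g) (hd : ∀ x y, dist (g x) (g y) = dist x y)
    {a b c : X} (hab : a ≠ b) (hac : a ≠ c) (hbc : b ≠ c) :
    g a = a ∨ g b = b ∨ g c = c := by
  by_contra! hne
  have h1 := h g hg hd
  have h2 : {x | g x = x} ⊆ ({a, b, c} : Set X)ᶜ := by
    rintro x (hx : g x = x) (rfl | rfl | rfl)
    exacts [hne.1 hx, hne.2.1 hx, hne.2.2 hx]
  have h3 := Set.ncard_le_ncard h2
  have h4 := Set.ncard_add_ncard_compl ({a, b, c} : Set X)
  have h5 : ({a, b, c} : Set X).ncard = 3 := Set.ncard_eq_three.2 ⟨a, b, c, hab, hac, hbc, rfl⟩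
  omega

theorem maxRigid.eq_or_eq_of_isTwin {X : Type*} [MetricSpace X] [Finite X] (h : maxRigid X)
    {x y p q : X} (hxy : IsTwin x y) (hpq : IsTwin p q) (hne : x ≠ y) (hne' : p ≠ q) :
    x = p ∨ x = q := by
  classical
  by_contra! hx
  have := h.eq_or_eq_or_eq (g := fun z => Equiv.swap x y (Equiv.swap p q z))
    ((Equiv.swap x y).surjective.comp (Equiv.swap p q).surjective)
    (fun a b => (hxy.dist_swap _ _).trans (hpq.dist_swap a b)) hx.1 hx.2 hne'
  simp only [Equiv.swap_apply_def] at this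
  grind

theorem maxRigid.dist_le_max {X : Type*} [MetricSpace X] [IsUltrametricDist X] [Finite X]
    (h : maxRigid X) {x y x' y' : X} (hx : x ≠ x') (hy : y ≠ y') :
    dist x y ≤ max (dist x x') (dist y y') := by
  by_contra! hlt
  obtain ⟨hlx, hly⟩ := max_lt_iff.1 hlt
  obtain ⟨p, q, hp, hq, hpq, ht, -⟩ := exists_isTwin (fun z => dist x z < dist x y)
    (by simpa using dist_nonneg.trans_lt hlx) hx
    fun p q hp hpq => (dist_triangle_max x p q).trans_lt (max_lt hp (hpq.trans_lt hlx))
  obtain ⟨a, b, ha, hb, hab, ht', -⟩ := exists_isTwin (fun z => dist y z < dist x y)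
    (by simpa using dist_nonneg.trans_lt hlx) hy
    fun p q hp hpq => (dist_triangle_max y p q).trans_lt (max_lt hp (hpq.trans_lt hly))
  have key : ∀ z, dist x z < dist x y → dist y z < dist x y → False := fun z h1 h2 =>
    ((dist_triangle_max x z y).trans_lt (max_lt h1 (by rwa [dist_comm z y]))).false
  rcases h.eq_or_eq_of_isTwin ht ht' hpq hab with rfl | rfl
  exacts [key _ hp ha, key _ hp hb]

/-- In a maximally rigid space, nearest-neighbour distances determine all distances, and ordering
the points by decreasing nearest-neighbour distance gives strictly decreasing steps. -/
theorem maxRigid.exists_enumeration {X : Type*} [MetricSpace X] [IsUltrametricDist X] [Fintype X]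
    (h : maxRigid X) {n : ℕ} (hn : n = Fintype.card X) (hcard : 2 ≤ n) :
    ∃ (x : Fin n → X) (ρ : X → ℝ), Function.Bijective x ∧ (∀ a, 0 ≤ ρ a) ∧
      (∀ i j, i < j → dist (x i) (x j) = ρ (x i)) ∧ Antitone (ρ ∘ x) ∧
      ∀ i j k, i < j → j < k → ρ (x j) < ρ (x i) := by
  have : Nontrivial X := Fintype.one_lt_card_iff_nontrivial.1 (by omega)
  have hnn : ∀ x : X, ∃ y, x ≠ y ∧ ∀ z, x ≠ z → dist x y ≤ dist x z := fun x => by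
    obtain ⟨y, hy, hm⟩ := Set.exists_min_image {y | x ≠ y} (dist x) (Set.toFinite _)
      ((exists_ne x).imp fun _ => Ne.symm)
    exact ⟨y, hy, hm⟩
  choose f hf hmin using hnn
  set ρ : X → ℝ := fun a => dist a (f a)
  have hdist : ∀ a b, a ≠ b → dist a b = max (ρ a) (ρ b) := fun a b hab =>
    le_antisymm (h.dist_le_max (hf a) (hf b))
      (max_le (hmin a b hab) (dist_comm a b ▸ hmin b a hab.symm))
  have htwin : ∀ a b, ρ a = ρ b → IsTwin a b := fun a b hab z hza hzb => by
    rw [hdist a z hza.symm, hdist b z hzb.symm, hab]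
  let e := Fintype.equivFinOfCardEq hn.symm
  let σ := Tuple.sort (fun i => -ρ (e.symm i))
  have hanti : Antitone (ρ ∘ (σ.trans e.symm)) := fun i j hij => by
    simpa using Tuple.monotone_sort (fun i => -ρ (e.symm i)) hij
  refine ⟨σ.trans e.symm, ρ, (σ.trans e.symm).bijective, fun _ => dist_nonneg, ?_, hanti, ?_⟩
  · intro i j hij
    rw [hdist _ _ ((σ.trans e.symm).injective.ne hij.ne), max_eq_left]
    exact hanti hij.le
  · generalize σ.trans e.symm = x at hanti
    intro i j k hij hjk
    refine (hanti hij.le).lt_of_ne fun heq => ?_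
    obtain ⟨p, q, -, -, hpq, ht, hglob⟩ := exists_isTwin (fun _ : X => True) trivial
      (hf (x i)) fun _ _ _ _ => trivial
    have heq : ρ (x j) = ρ (x i) := heq
    have hne : ∀ {i j}, i < j → x i ≠ x j := fun hij => x.injective.ne hij.ne
    have hi := h.eq_or_eq_of_isTwin (htwin _ _ heq.symm) ht (hne hij) hpq
    have hj := h.eq_or_eq_of_isTwin (htwin _ _ heq) ht (hne hij).symm hpq
    have hle : ρ (x j) ≤ ρ (x k) := by
      have h1 : ρ p ≤ ρ (x k) := (hmin p q hpq).trans (hglob _ _ trivial (hf _))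
      have h2 : ρ q ≤ ρ (x k) :=
        (hmin q p hpq.symm).trans ((dist_comm q p).trans_le (hglob _ _ trivial (hf _)))
      rcases hj with hj | hj <;> rwa [hj]
    have hk := h.eq_or_eq_of_isTwin (htwin _ _ (le_antisymm (hanti hjk.le) hle)) ht
      (hne hjk).symm hpq
    have := hne hij
    have := hne hjk
    have := hne (hij.trans hjk)
    grind

theorem dist_eq_of_strictly_decreasing {X : Type*} [MetricSpace X] [IsUltrametricDist X]
    {n : ℕ} {x : Fin n → X}
    (hx : ∀ k : ℕ, (hk : k + 2 < n) →
      dist (x ⟨k + 1, by omega⟩) (x ⟨k + 2, by omega⟩) <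
        dist (x ⟨k, by omega⟩) (x ⟨k + 1, by omega⟩))
    (m i : ℕ) (h : i + 1 + m < n) :
    dist (x ⟨i, by omega⟩) (x ⟨i + 1 + m, h⟩) =
      dist (x ⟨i, by omega⟩) (x ⟨i + 1, by omega⟩) := by
  induction m generalizing i with
  | zero => rfl
  | succ m ih =>
    have h1 := ih (i + 1) (by omega)
    have h2 := hx i (by omega)
    have e : (⟨i + 1 + (m + 1), h⟩ : Fin n) = ⟨i + 1 + 1 + m, by omega⟩ := by
      ext; simp; omega
    rw [e]
    have h3 := h1.trans_lt h2
    rw [IsUltrametricDist.dist_eq_max_of_dist_ne_dist _ _ _ h3.ne', max_eq_left h3.le]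

theorem maxRigid_of_strictly_decreasing {X : Type*} [MetricSpace X] [IsUltrametricDist X]
    {n : ℕ} {x : Fin n → X} (hbij : Function.Bijective x)
    (hx : ∀ k : ℕ, (hk : k + 2 < n) →
      dist (x ⟨k + 1, by omega⟩) (x ⟨k + 2, by omega⟩) <
        dist (x ⟨k, by omega⟩) (x ⟨k + 1, by omega⟩)) :
    maxRigid X := by
  intro g hg hd
  have hginj : Function.Injective g := fun a b hab => by
    rw [← dist_eq_zero, ← hd, hab, dist_self]
  have : Finite X := Finite.of_surjective x hbij.2
  have hdist : ∀ i j : Fin n, (hij : i < j) →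
      dist (x i) (x j) = dist (x i) (x ⟨i + 1, by omega⟩) := fun i j hij => by
    have := dist_eq_of_strictly_decreasing hx (j - (i + 1)) i (by omega)
    have e : (⟨i + 1 + (j - (i + 1)), by omega⟩ : Fin n) = j := by ext; simp; omega
    rwa [e] at this
  have hanti : ∀ (m i : ℕ) (h : i + 1 + m + 1 < n),
      dist (x ⟨i + 1 + m, by omega⟩) (x ⟨i + 1 + m + 1, h⟩) <
        dist (x ⟨i, by omega⟩) (x ⟨i + 1, by omega⟩) := fun m i h => by
    induction m with
    | zero => exact hx i (by omega)
    | succ m ih => exact (hx (i + 1 + m) (by omega)).trans (ih (by omega))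
  have hlt : ∀ i j k : Fin n, (hij : i < j) → j < k →
      dist (x j) (x k) < dist (x i) (x ⟨i + 1, by omega⟩) := fun i j k hij hjk => by
    rw [hdist j k hjk]
    have := hanti (j - (i + 1)) i (by omega)
    have e : (⟨i + 1 + (j - (i + 1)), by omega⟩ : Fin n) = j := by ext; simp; omega
    have e' : (⟨i + 1 + (j - (i + 1)) + 1, by omega⟩ : Fin n) = ⟨j + 1, by omega⟩ := by
      ext; simp; omega
    rwa [e, e'] at this
  have hfix : ∀ i : ℕ, (hi : i + 2 < n) → g (x ⟨i, by omega⟩) = x ⟨i, by omega⟩ := by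
    intro i
    induction i using Nat.strong_induction_on with
    | _ i ih =>
      intro hi
      have hfix' : ∀ l : Fin n, l.1 < i → g (x l) = x l := fun l hl => ih l hl (by omega)
      obtain ⟨m, hm⟩ := hbij.2 (g (x ⟨i, by omega⟩))
      by_contra hne
      have hmi : i < m.1 := by
        by_contra! hle
        rcases hle.lt_or_eq with hlt' | heq
        · have := hginj ((hfix' m hlt').trans hm)
          have := congrArg Fin.val (hbij.1 this)
          simp at this; omega
        · exact hne (by rw [← hm]; congr 1; exact Fin.ext heq)
      obtain ⟨j, hij, hjm⟩ : ∃ j : Fin n, i < j.1 ∧ j ≠ m := by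
        by_cases h : m.1 = i + 1
        · exact ⟨⟨i + 2, hi⟩, by simp, fun e => by have := congrArg Fin.val e; simp at this; omega⟩
        · exact ⟨⟨i + 1, by omega⟩, by simp, fun e => h (congrArg Fin.val e).symm⟩
      obtain ⟨a, ha⟩ := hg (x j)
      obtain ⟨l, rfl⟩ := hbij.2 a
      have hli : i < l.1 := by
        by_contra! hle
        rcases hle.lt_or_eq with hlt' | heq
        · have := hbij.1 ((hfix' l hlt').symm.trans ha)
          omega
        · have e : l = ⟨i, by omega⟩ := Fin.ext heq
          rw [e, ← hm] at ha
          exact hjm (hbij.1 ha).symm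
      have h1 : dist (x m) (x j) = dist (x ⟨i, by omega⟩) (x ⟨i + 1, by omega⟩) := by
        rw [hm, ← ha, hd]
        exact hdist ⟨i, by omega⟩ l hli
      rcases lt_or_gt_of_ne hjm with h | h
      · exact (hlt ⟨i, by omega⟩ j m hij h).ne (by rw [dist_comm, h1])
      · exact (hlt ⟨i, by omega⟩ m j hmi h).ne h1
  have hcard : Nat.card X = n := by
    rw [← Nat.card_eq_of_bijective x hbij, Nat.card_fin]
  have hinj : Function.Injective fun i : Fin (n - 2) => x ⟨i, by omega⟩ := fun i j hij =>
    Fin.ext (Fin.mk.inj (hbij.1 hij))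
  have hr := Set.ncard_le_ncard (s := Set.range fun i : Fin (n - 2) => x ⟨i, by omega⟩)
    (t := {x | g x = x}) (by rintro _ ⟨i, rfl⟩; exact hfix i (by omega))
  rwa [← Set.image_univ, Set.ncard_image_of_injective _ hinj, Set.ncard_univ, Nat.card_fin,
    ← hcard] at hr

/-- A finite ultrametric space `X` with `n = |X| ≥ 3` belongs
to `ℜ` if and only if there is an enumeration `x_1, …, x_n` (a Hamiltonian
cycle `x_1, …, x_n, x_1`) such that the two edges `{x_1, x_2}` and
`{x_n, x_1}` both attain the maximal distance among the `n` cycle edges and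
`d(x_k, x_{k+1}) > d(x_{k+1}, x_{k+2})` for `k = 1, …, n-2`.
(Here the enumeration is written with indices `0, …, n-1`.) -/
theorem stmt15 (X : Type*) [MetricSpace X] [IsUltrametricDist X] [Fintype X]
    (n : ℕ) (hn : n = Fintype.card X) (hcard : 3 ≤ n) :
    maxRigid X ↔
      ∃ x : Fin n → X, Function.Bijective x ∧
        dist (x ⟨0, by omega⟩) (x ⟨1, by omega⟩) =
          dist (x ⟨n - 1, by omega⟩) (x ⟨0, by omega⟩) ∧
        (∀ k : ℕ, (hk : k < n) →
          dist (x ⟨k, hk⟩) (x ⟨(k + 1) % n, Nat.mod_lt _ (by omega)⟩) ≤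
            dist (x ⟨0, by omega⟩) (x ⟨1, by omega⟩)) ∧
        ∀ k : ℕ, (hk : k + 2 < n) →
          dist (x ⟨k + 1, by omega⟩) (x ⟨k + 2, by omega⟩) <
            dist (x ⟨k, by omega⟩) (x ⟨k + 1, by omega⟩) := by
 
  refine ⟨fun h => ?_, fun ⟨x, hbij, _, _, hx⟩ => maxRigid_of_strictly_decreasing hbij hx⟩
  obtain ⟨x, ρ, hbij, hρ, hdist, hanti, hlt⟩ := h.exists_enumeration hn (by omega)
  have h01 := hdist ⟨0, by omega⟩ ⟨1, by omega⟩ (by simp)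
  have hle : ∀ i, ρ (x i) ≤ ρ (x ⟨0, by omega⟩) := fun i => hanti (Nat.zero_le i.1)
  refine ⟨x, hbij, ?_, fun k hk => ?_, fun k hk => ?_⟩
  · rw [h01, dist_comm, hdist _ _ (by simp; omega)]
  · rw [h01]
    rcases lt_trichotomy (⟨k, hk⟩ : Fin n) ⟨(k + 1) % n, Nat.mod_lt _ (by omega)⟩ with h | h | h
    · exact (hdist _ _ h).trans_le (hle _)
    · rw [← h, dist_self]
      exact hρ _
    · rw [dist_comm]
      exact (hdist _ _ h).trans_le (hle _)
  · rw [hdist ⟨k, _⟩ ⟨k + 1, _⟩ (by simp), hdist ⟨k + 1, _⟩ ⟨k + 2, _⟩ (by simp)]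
    exact hlt _ _ ⟨k + 2, hk⟩ (by simp) (by simp)
end

section
/- Let (X,d) and (Y,ρ) be finite ultrametric spaces with X ∈ ℜ and Y ∈ ℜ. Then X and Y are weakly similar if and only if |X| = |Y|. -/
/-- The spectrum of a metric space: the set of distances between its points. -/
def metricSpectrum (X : Type*) [MetricSpace X] : Set ℝ :=
  {r : ℝ | ∃ x y : X, dist x y = r}

/-- A bijection `Φ : X → Y` is a weak similarity if there is a strictly
increasing bijection `f : Sp(X) → Sp(Y)` with `f(d(x,y)) = ρ(Φ x, Φ y)`. -/
def IsWeakSimilarity {X Y : Type*} [MetricSpace X] [MetricSpace Y]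
    (Φ : X → Y) : Prop :=
  Function.Bijective Φ ∧ ∃ f : ℝ → ℝ,
    Set.BijOn f (metricSpectrum X) (metricSpectrum Y) ∧
    StrictMonoOn f (metricSpectrum X) ∧
    ∀ x y : X, f (dist x y) = dist (Φ x) (Φ y)

open Function

section

variable {X Y : Type*} [MetricSpace X] [MetricSpace Y]

/-- Transposing two points equidistant from every other point is an isometry. -/
lemma dist_swap_swap [DecidableEq X] {a b : X}
    (h : ∀ z, z ≠ a → z ≠ b → dist z a = dist z b) (x y : X) :
    dist (Equiv.swap a b x) (Equiv.swap a b y) = dist x y := by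
  have h' : ∀ z, z ≠ a → z ≠ b → dist a z = dist b z := fun z h₁ h₂ => by
    rw [dist_comm a, dist_comm b, h z h₁ h₂]
  have := dist_comm a b
  simp only [Equiv.swap_apply_def]
  split_ifs <;> simp_all

lemma IsUltrametricDist.dist_eq_dist_of_dist_le [IsUltrametricDist X] {x y z : X}
    (hx : dist x y ≤ dist z x) (hy : dist x y ≤ dist z y) : dist z x = dist z y := by
  apply le_antisymm
  · have := dist_triangle_max z y x
    rw [dist_comm y x] at this
    exact this.trans (max_le le_rfl hy)
  · exact (dist_triangle_max z x y).trans (max_le le_rfl hx)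

/-- Two distinct points at the same distance from `a` can be chosen equidistant from every
other point. -/
lemma exists_equidistant_pair [IsUltrametricDist X] [Finite X] {a x₀ y₀ : X} (hne : x₀ ≠ y₀)
    (h₀ : dist a x₀ = dist a y₀) :
    ∃ x y : X, x ≠ y ∧ dist a x = dist a y ∧
      ∀ z, z ≠ x → z ≠ y → dist z x = dist z y := by
  obtain ⟨⟨x, y⟩, ⟨hxy, hd⟩, hmin⟩ := Set.exists_min_image
    {p : X × X | p.1 ≠ p.2 ∧ dist a p.1 = dist a p.2} (fun p => dist p.1 p.2)
    (Set.toFinite _) ⟨(x₀, y₀), hne, h₀⟩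
  dsimp only at hxy hd hmin
  have hxyr : dist x y ≤ dist a x := by
    have := dist_triangle_max x a y
    rwa [dist_comm x a, hd, max_self, ← hd] at this
  have key : ∀ z w, z ≠ w → dist a w = dist a x → dist x y ≤ dist z w := by
    intro z w hzw hw
    by_contra! hlt
    have hz : dist a z = dist a w := by
      have h₁ := dist_triangle_max a w z
      have h₂ := dist_triangle_max a z w
      rw [dist_comm w z] at h₁
      grind
    exact hlt.not_ge (hmin (z, w) ⟨hzw, hz⟩)
  exact ⟨x, y, hxy, hd, fun z hzx hzy => IsUltrametricDist.dist_eq_dist_of_dist_le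
    (key z x hzx rfl) (key z y hzy hd.symm)⟩

/-- In a space of `ℜ` some point is determined by its distances to the others. -/
lemma maxRigid.exists_injective_dist [IsUltrametricDist X] [Fintype X] (hX : maxRigid X)
    (h2 : 2 ≤ Fintype.card X) : ∃ a : X, Injective (dist a) := by
  classical
  obtain ⟨p, q, hpq⟩ := Fintype.one_lt_card_iff.mp h2
  obtain ⟨⟨a, b⟩, hab, hmin⟩ := Set.exists_min_image {p : X × X | p.1 ≠ p.2}
    (fun p => dist p.1 p.2) (Set.toFinite _) ⟨(p, q), hpq⟩
  replace hab : a ≠ b := hab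
  have htwin : ∀ z, z ≠ a → z ≠ b → dist z a = dist z b := fun z h₁ h₂ =>
    IsUltrametricDist.dist_eq_dist_of_dist_le (hmin (z, a) h₁) (hmin (z, b) h₂)
  refine ⟨a, fun x₀ y₀ h₀ => ?_⟩
  by_contra hne
  obtain ⟨x, y, hxy, hd, hz⟩ := exists_equidistant_pair hne h₀
  have hax : a ≠ x := by
    rintro rfl
    exact hxy (dist_eq_zero.mp (by rw [← hd, dist_self]))
  have hay : a ≠ y := by
    rintro rfl
    exact hxy (dist_eq_zero.mp (by rw [dist_comm, hd, dist_self]))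
  set g := (Equiv.swap x y).trans (Equiv.swap a b) with hg
  have hfix := hX g g.surjective fun u v => by
    simp only [hg, Equiv.trans_apply, dist_swap_swap htwin, dist_swap_swap hz]
  have hsub : {u | g u = u} ⊆ ((({a, x, y} : Finset X)ᶜ : Finset X) : Set X) := by
    intro u hu
    simp only [Set.mem_ofPred_eq, hg, Equiv.trans_apply, Equiv.swap_apply_def] at hu
    simp only [Finset.coe_compl, Set.mem_compl_iff, Finset.mem_coe, Finset.mem_insert,
      Finset.mem_singleton]
    grind
  have hle := Set.ncard_le_ncard hsub (Set.toFinite _)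
  have h3 : ({a, x, y} : Finset X).card = 3 :=
    Finset.card_eq_three.mpr ⟨a, x, y, hax, hay, hxy, rfl⟩
  have hcard := Finset.card_le_univ ({a, x, y} : Finset X)
  rw [Set.ncard_coe_finset, Finset.card_compl, h3] at hle
  rw [Nat.card_eq_fintype_card] at hfix
  omega

/-- Finite types of equal cardinality, ordered along injective functions to a linear order, are
order isomorphic. -/
lemma exists_equiv_lt_iff_lt {α β γ : Type*} [Fintype α] [Fintype β] [LinearOrder γ]
    {p : α → γ} {q : β → γ} (hp : Injective p) (hq : Injective q)
    (h : Fintype.card α = Fintype.card β) :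
    ∃ e : α ≃ β, ∀ x y, q (e x) < q (e y) ↔ p x < p y := by
  let _ := LinearOrder.lift' p hp
  let _ := LinearOrder.lift' q hq
  let e : α ≃o β := (Fintype.orderIsoFinOfCardEq α h).symm.trans
    (Fintype.orderIsoFinOfCardEq β rfl)
  exact ⟨e.toEquiv, fun x y => e.lt_iff_lt⟩

lemma dist_eq_max_of_injective_dist [IsUltrametricDist X] {a : X} (ha : Injective (dist a))
    {x y : X} (h : x ≠ y) : dist x y = max (dist a x) (dist a y) := by
  rw [dist_comm a x]
  exact IsUltrametricDist.dist_eq_max_of_dist_ne_dist x a y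
    (by rw [dist_comm x a]; exact ha.ne h)

lemma metricSpectrum_eq_range [IsUltrametricDist X] {a : X} (ha : Injective (dist a)) :
    metricSpectrum X = Set.range (dist a) := by
  ext r
  constructor
  · rintro ⟨x, y, rfl⟩
    rcases eq_or_ne x y with rfl | h
    · exact ⟨a, by simp⟩
    · rw [dist_eq_max_of_injective_dist ha h]
      rcases max_choice (dist a x) (dist a y) with h | h <;> rw [h] <;> exact ⟨_, rfl⟩
  · rintro ⟨x, rfl⟩
    exact ⟨a, x, rfl⟩

lemma exists_isWeakSimilarity_of_injective_dist [IsUltrametricDist X] [IsUltrametricDist Y]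
    [Fintype X] [Fintype Y] {a : X} {b : Y} (ha : Injective (dist a)) (hb : Injective (dist b))
    (h : Fintype.card X = Fintype.card Y) : ∃ Φ : X → Y, IsWeakSimilarity Φ := by
  obtain ⟨e, he⟩ := exists_equiv_lt_iff_lt ha hb h
  have hea : e a = b := by
    by_contra hne
    have := (he (e.symm b) a).mp (by simpa using fun h => hne h.symm)
    rw [dist_self] at this
    exact this.not_ge dist_nonneg
  obtain ⟨f, hf⟩ : ∃ f : ℝ → ℝ, ∀ x, f (dist a x) = dist b (e x) :=
    ⟨extend (dist a) (fun x => dist b (e x)) 0, fun x => ha.extend_apply _ _ x⟩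
  have hmono : StrictMonoOn f (metricSpectrum X) := by
    rw [metricSpectrum_eq_range ha]
    rintro _ ⟨x, rfl⟩ _ ⟨y, rfl⟩ hxy
    rw [hf, hf, he]
    exact hxy
  refine ⟨e, e.bijective, f, ⟨?_, hmono.injOn, ?_⟩, hmono, fun x y => ?_⟩
  · rw [metricSpectrum_eq_range ha, metricSpectrum_eq_range hb]
    rintro _ ⟨x, rfl⟩
    exact ⟨e x, (hf x).symm⟩
  · rw [metricSpectrum_eq_range ha, metricSpectrum_eq_range hb]
    rintro _ ⟨y, rfl⟩
    exact ⟨_, ⟨e.symm y, rfl⟩, by rw [hf, e.apply_symm_apply]⟩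
  · rcases eq_or_ne x y with rfl | hxy
    · simpa [hea] using hf a
    · rw [dist_eq_max_of_injective_dist ha hxy,
        dist_eq_max_of_injective_dist hb (e.injective.ne hxy), ← hf, ← hf]
      rw [metricSpectrum_eq_range ha] at hmono
      exact hmono.monotoneOn.map_max ⟨x, rfl⟩ ⟨y, rfl⟩

end

/-- Two finite ultrametric spaces `X, Y ∈ ℜ` are weakly
similar if and only if `|X| = |Y|`. -/
theorem stmt19 (X : Type*) [MetricSpace X] [IsUltrametricDist X] [Fintype X]
    (Y : Type*) [MetricSpace Y] [IsUltrametricDist Y] [Fintype Y]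
    (hX2 : 2 ≤ Fintype.card X) (hY2 : 2 ≤ Fintype.card Y)
    (hX : maxRigid X) (hY : maxRigid Y) :
    (∃ Φ : X → Y, IsWeakSimilarity Φ) ↔ Fintype.card X = Fintype.card Y := by
  constructor
  · rintro ⟨Φ, hΦ, -⟩
    exact Fintype.card_of_bijective hΦ
  · intro h
    obtain ⟨a, ha⟩ := hX.exists_injective_dist hX2
    obtain ⟨b, hb⟩ := hY.exists_injective_dist hY2
    exact exists_isWeakSimilarity_of_injective_dist ha hb h
end
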